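/- Let ε > 0 and let n, m ≥ 0 be integers. Then: (i) ε^{4n+2} ∫_{−∞}^{∞} a(τ)^{4n+3} b(τ) e^{i (2m+1) ψ_ε(τ)} dτ = (2/3) (2√2)^{4(n+1)} ε^{4n+2} ∫_{−∞}^{∞} e^{− i (2m+1) z/(24 ε³)} y(z) (y(z) + 2i)^{−(2(n+m)+5)} (y(z) − 2i)^{−(2(n−m)+3)} dz; and (ii) for m ≥ 1, ε^{4n} ∫_{−∞}^{∞} a(τ)^{4n+1} b(τ) e^{i 2m ψ_ε(τ)} dτ = −(2/3) (2√2)^{4n+2} ε^{4n} ∫_{−∞}^{∞} e^{− i m z/(12 ε³)} y(z) (y(z) + 2i)^{−(2(n+m)+3)} (y(z) − 2i)^{−(2(n−m)+3)} dz. Negative integer exponents denote positive powers in the numerator. -/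

import Mathlib

open MeasureTheory

/-- `a(τ) = 2√2/(e^τ + e^{−τ})`. -/
noncomputable def aa (τ : ℝ) : ℝ := 2 * Real.sqrt 2 / (Real.exp τ + Real.exp (-τ))

/-- `b(τ) = 2√2 (e^{−τ} − e^τ)/(e^τ + e^{−τ})²`. -/
noncomputable def bb (τ : ℝ) : ℝ :=
  2 * Real.sqrt 2 * (Real.exp (-τ) - Real.exp τ) / (Real.exp τ + Real.exp (-τ)) ^ 2

/-- `ψ_ε(τ)`. -/
noncomputable def psi (ε τ : ℝ) : ℝ :=
  2 * Real.arctan ((Real.exp τ - Real.exp (-τ)) / 2)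
    - (1 / (48 * ε ^ 3)) * (Real.exp (3 * τ) - Real.exp (-(3 * τ)))
    - (3 / (16 * ε ^ 3)) * (Real.exp τ - Real.exp (-τ))

/-- `y(z) = (√(z² + 64) + z)^{1/3} − (√(z² + 64) − z)^{1/3}`. -/
noncomputable def yy (z : ℝ) : ℝ :=
  (Real.sqrt (z ^ 2 + 64) + z) ^ ((1 : ℝ) / 3) - (Real.sqrt (z ^ 2 + 64) - z) ^ ((1 : ℝ) / 3)

theorem yy_cubic (z : ℝ) : yy z ^ 3 + 12 * yy z = 2 * z := by
  have hlt : |z| < Real.sqrt (z ^ 2 + 64) := by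
    rw [← Real.sqrt_sq_eq_abs]
    exact Real.sqrt_lt_sqrt (sq_nonneg z) (by linarith)
  obtain ⟨h1, h2⟩ := abs_lt.mp hlt
  have hp : 0 ≤ Real.sqrt (z ^ 2 + 64) + z := by linarith
  have hm : 0 ≤ Real.sqrt (z ^ 2 + 64) - z := by linarith
  have hs : Real.sqrt (z ^ 2 + 64) ^ 2 = z ^ 2 + 64 := Real.sq_sqrt (by positivity)
  have cube : ∀ x : ℝ, 0 ≤ x → (x ^ ((1 : ℝ) / 3)) ^ 3 = x := fun x hx => by
    rw [← Real.rpow_natCast, ← Real.rpow_mul hx]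
    norm_num
  have hprod : (Real.sqrt (z ^ 2 + 64) + z) ^ ((1 : ℝ) / 3) *
      (Real.sqrt (z ^ 2 + 64) - z) ^ ((1 : ℝ) / 3) = 4 := by
    rw [← Real.mul_rpow hp hm,
      show (Real.sqrt (z ^ 2 + 64) + z) * (Real.sqrt (z ^ 2 + 64) - z) = (4 : ℝ) ^ (3 : ℝ) by
        norm_num; linear_combination hs,
      ← Real.rpow_mul (by norm_num)]
    norm_num
  have hA := cube _ hp
  have hB := cube _ hm
  unfold yy
  set A := (Real.sqrt (z ^ 2 + 64) + z) ^ ((1 : ℝ) / 3)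
  set B := (Real.sqrt (z ^ 2 + 64) - z) ^ ((1 : ℝ) / 3)
  linear_combination hA - hB - 3 * (A - B) * hprod

theorem cubic_injective {y w : ℝ} (h : y ^ 3 + 12 * y = w ^ 3 + 12 * w) : y = w := by
  have h0 : (y - w) * (y ^ 2 + y * w + w ^ 2 + 12) = 0 := by linear_combination h
  rcases mul_eq_zero.mp h0 with h1 | h1
  · linarith
  · nlinarith [sq_nonneg (y + w), sq_nonneg y, sq_nonneg w]

/-- The substitution `z(τ) = (y³ + 12 y) / 2` with `y = e^τ − e^{−τ}`. -/
noncomputable def zz (τ : ℝ) : ℝ :=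
  ((Real.exp τ - Real.exp (-τ)) ^ 3 + 12 * (Real.exp τ - Real.exp (-τ))) / 2

theorem yy_zz (τ : ℝ) : yy (zz τ) = Real.exp τ - Real.exp (-τ) :=
  cubic_injective (by rw [yy_cubic, zz]; ring)

theorem exp_sub_exp_neg_eq (τ : ℝ) : Real.exp τ - Real.exp (-τ) = 2 * Real.sinh τ := by
  rw [Real.sinh_eq]; ring

theorem zz_bijective : Function.Bijective zz := by
  constructor
  · intro s t h
    have h2 : yy (zz s) = yy (zz t) := by rw [h]
    rw [yy_zz, yy_zz, exp_sub_exp_neg_eq, exp_sub_exp_neg_eq] at h2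
    exact Real.sinh_injective (by linarith)
  · intro z
    refine ⟨Real.arsinh (yy z / 2), ?_⟩
    rw [zz, exp_sub_exp_neg_eq, Real.sinh_arsinh]
    linear_combination yy_cubic z / 2

theorem sq_exp_add_exp_neg (τ : ℝ) :
    (Real.exp τ + Real.exp (-τ)) ^ 2 = (Real.exp τ - Real.exp (-τ)) ^ 2 + 4 := by
  have h : Real.exp τ * Real.exp (-τ) = 1 := by rw [← Real.exp_add]; simp
  linear_combination 4 * h

theorem hasDerivAt_zz (τ : ℝ) :
    HasDerivAt zz (3 / 2 * (Real.exp τ + Real.exp (-τ)) ^ 3) τ := by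
  have h : HasDerivAt (fun t : ℝ => Real.exp t - Real.exp (-t))
      (Real.exp τ + Real.exp (-τ)) τ := by
    refine ((Real.hasDerivAt_exp τ).sub (hasDerivAt_neg τ).exp).congr_deriv ?_
    ring
  refine (((h.pow 3).add (h.const_mul 12)).div_const 2).congr_deriv ?_
  push_cast
  linear_combination (-3 / 2 * (Real.exp τ + Real.exp (-τ))) * sq_exp_add_exp_neg τ

theorem integral_comp_zz (g : ℝ → ℂ) :
    ∫ z, g z = ∫ τ, ((3 / 2 * (Real.exp τ + Real.exp (-τ)) ^ 3 : ℝ) : ℂ) * g (zz τ) := by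
  have h := integral_image_eq_integral_abs_deriv_smul MeasurableSet.univ
    (fun τ _ => (hasDerivAt_zz τ).hasDerivWithinAt) zz_bijective.1.injOn g
  rw [Set.image_univ, zz_bijective.2.range_eq, setIntegral_univ, setIntegral_univ] at h
  rw [h]
  refine integral_congr_ae (Filter.Eventually.of_forall fun τ => ?_)
  have : 0 ≤ 3 / 2 * (Real.exp τ + Real.exp (-τ)) ^ 3 := by positivity
  simp only [abs_of_nonneg this, Complex.real_smul]

theorem add_two_I_ne_zero (y : ℝ) : (y : ℂ) + 2 * Complex.I ≠ 0 := fun h => by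
  simpa using congrArg Complex.im h

theorem sub_two_I_ne_zero (y : ℝ) : (y : ℂ) - 2 * Complex.I ≠ 0 := fun h => by
  simpa using congrArg Complex.im h

theorem add_two_I_mul_sub_two_I (y : ℂ) :
    (y + 2 * Complex.I) * (y - 2 * Complex.I) = y ^ 2 + 4 := by
  linear_combination (-4) * Complex.I_sq

theorem exp_I_mul_two_arctan (y : ℝ) :
    Complex.exp (Complex.I * (2 * Real.arctan (y / 2) : ℝ)) =
      -((y : ℂ) - 2 * Complex.I) / ((y : ℂ) + 2 * Complex.I) := by
  set θ := Real.arctan (y / 2) with hθ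
  have hc : Real.cos θ ^ 2 * (y ^ 2 + 4) = 4 := by
    rw [hθ, Real.cos_sq_arctan]
    field_simp
    ring
  have hs : Real.sin θ = y / 2 * Real.cos θ := by
    rw [← Real.tan_mul_cos (Real.cos_arctan_pos (y / 2)).ne', Real.tan_arctan]
  have hcC : (Real.cos θ : ℂ) ^ 2 * ((y : ℂ) ^ 2 + 4) = 4 := by exact_mod_cast hc
  have hsC : (Real.sin θ : ℂ) = y / 2 * Real.cos θ := by exact_mod_cast hs
  have hE : Complex.exp (Complex.I * (2 * θ : ℝ)) =
      (Real.cos θ + Real.sin θ * Complex.I) ^ 2 := by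
    rw [Complex.ofReal_cos, Complex.ofReal_sin, ← Complex.exp_mul_I, ← Complex.exp_nat_mul]
    push_cast
    congr 1
    ring
  rw [hE, hsC, eq_div_iff (add_two_I_ne_zero y)]
  have hP := add_two_I_mul_sub_two_I y
  have hI := Complex.I_sq
  have h1 : (1 + (y : ℂ) / 2 * Complex.I) = Complex.I / 2 * (y - 2 * Complex.I) := by
    linear_combination hI
  calc _ = (Real.cos θ : ℂ) ^ 2 * (1 + (y : ℂ) / 2 * Complex.I) ^ 2 * (y + 2 * Complex.I) := by ring
    _ = (Real.cos θ : ℂ) ^ 2 * (Complex.I ^ 2 / 4) * (y - 2 * Complex.I) *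
        ((y + 2 * Complex.I) * (y - 2 * Complex.I)) := by rw [h1]; ring
    _ = _ := by
      rw [hP, hI]
      linear_combination (-((y : ℂ) - 2 * Complex.I) / 4) * hcC

theorem psi_eq (ε τ : ℝ) :
    psi ε τ = 2 * Real.arctan ((Real.exp τ - Real.exp (-τ)) / 2) - zz τ / (24 * ε ^ 3) := by
  have h : Real.exp τ * Real.exp (-τ) = 1 := by rw [← Real.exp_add]; simp
  have h3 : Real.exp (3 * τ) = Real.exp τ ^ 3 := by rw [← Real.exp_nat_mul]; norm_num
  have h3' : Real.exp (-(3 * τ)) = Real.exp (-τ) ^ 3 := by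
    rw [← Real.exp_nat_mul]; congr 1; push_cast; ring
  rw [psi, zz, h3, h3']
  linear_combination
    (-(Real.exp τ - Real.exp (-τ)) / (16 * ε ^ 3)) * h

theorem exp_psi (ε τ : ℝ) (k : ℕ) :
    Complex.exp (k * (Complex.I * psi ε τ)) =
      (-((yy (zz τ) : ℂ) - 2 * Complex.I) / ((yy (zz τ) : ℂ) + 2 * Complex.I)) ^ k *
        Complex.exp (-(Complex.I * k * zz τ) / (24 * (ε : ℂ) ^ 3)) := by
  rw [yy_zz, ← exp_I_mul_two_arctan, ← Complex.exp_nat_mul, ← Complex.exp_add, psi_eq]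
  congr 1
  push_cast
  ring

/-- The change of variables `z = zz τ` for a general odd power of `aa` and a general frequency. -/
theorem integral_aa_pow_mul_bb (ε : ℝ) (p k : ℕ) :
    ∫ τ : ℝ, (((aa τ) ^ (2 * p + 1) * bb τ : ℝ) : ℂ) * Complex.exp (k * (Complex.I * psi ε τ)) =
      (-1) ^ (k + 1) * (2 / 3) * ((2 * Real.sqrt 2 : ℝ) : ℂ) ^ (2 * p + 2) *
        ∫ z : ℝ, Complex.exp (-(Complex.I * k * z) / (24 * (ε : ℂ) ^ 3)) * (yy z : ℂ) *
          ((yy z : ℂ) + 2 * Complex.I) ^ (-((p : ℤ) + 3 + k)) *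
          ((yy z : ℂ) - 2 * Complex.I) ^ (-((p : ℤ) + 3 - k)) := by
  conv_rhs => rw [integral_comp_zz, ← integral_const_mul]
  refine integral_congr_ae (Filter.Eventually.of_forall fun τ => ?_)
  beta_reduce
  rw [exp_psi]
  have hb : (aa τ) ^ (2 * p + 1) * bb τ = -((2 * Real.sqrt 2) ^ (2 * p + 2) * yy (zz τ) *
      (Real.exp τ + Real.exp (-τ)) ^ 3 / ((Real.exp τ + Real.exp (-τ)) ^ 2) ^ (p + 3)) := by
    have : Real.exp τ + Real.exp (-τ) ≠ 0 := by positivity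
    rw [yy_zz, aa, bb, div_pow, ← pow_mul]
    field_simp
    ring
  rw [hb, sq_exp_add_exp_neg, ← yy_zz]
  have hP := add_two_I_ne_zero (yy (zz τ))
  have hM := sub_two_I_ne_zero (yy (zz τ))
  have hz1 : ((yy (zz τ) : ℂ) + 2 * Complex.I) ^ (-((p : ℤ) + 3 + k)) =
      (((yy (zz τ) : ℂ) + 2 * Complex.I) ^ (p + 3 + k))⁻¹ := by
    rw [zpow_neg]; norm_cast
  have hz2 : ((yy (zz τ) : ℂ) - 2 * Complex.I) ^ (-((p : ℤ) + 3 - k)) =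
      ((yy (zz τ) : ℂ) - 2 * Complex.I) ^ k / ((yy (zz τ) : ℂ) - 2 * Complex.I) ^ (p + 3) := by
    rw [show -((p : ℤ) + 3 - k) = (k : ℤ) - ((p + 3 : ℕ) : ℤ) by push_cast; ring,
      zpow_sub₀ hM, zpow_natCast, zpow_natCast]
  rw [hz1, hz2]
  push_cast
  rw [← add_two_I_mul_sub_two_I]
  generalize (yy (zz τ) : ℂ) + 2 * Complex.I = P at *
  generalize (yy (zz τ) : ℂ) - 2 * Complex.I = M at *
  rw [div_pow, neg_pow M k, mul_pow, pow_add P (p + 3) k]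
  field_simp
  ring

/-- The integrals `J_{n,m,odd}` and `J_{n,m,even}` expressed as integrals in the variable `z`. -/
theorem J_odd_even_change_of_variables
    (ε : ℝ) (hε : 0 < ε) (n m : ℕ) :
    ((ε : ℂ) ^ (4 * n + 2) *
        ∫ τ : ℝ, (((aa τ) ^ (4 * n + 3) * bb τ : ℝ) : ℂ) *
          Complex.exp (Complex.I * (2 * (m : ℂ) + 1) * (psi ε τ : ℂ))
      = (2 / 3 : ℂ) * ((2 * Real.sqrt 2 : ℝ) : ℂ) ^ (4 * (n + 1)) * (ε : ℂ) ^ (4 * n + 2) *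
          ∫ z : ℝ,
            Complex.exp (-(Complex.I * (2 * (m : ℂ) + 1) * (z : ℂ)) / (24 * (ε : ℂ) ^ 3)) *
              (yy z : ℂ) *
              ((yy z : ℂ) + 2 * Complex.I) ^ (-(2 * ((n : ℤ) + (m : ℤ)) + 5)) *
              ((yy z : ℂ) - 2 * Complex.I) ^ (-(2 * ((n : ℤ) - (m : ℤ)) + 3))) ∧
    (1 ≤ m →
      (ε : ℂ) ^ (4 * n) *
          ∫ τ : ℝ, (((aa τ) ^ (4 * n + 1) * bb τ : ℝ) : ℂ) *
            Complex.exp (Complex.I * 2 * (m : ℂ) * (psi ε τ : ℂ))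
        = -(2 / 3 : ℂ) * ((2 * Real.sqrt 2 : ℝ) : ℂ) ^ (4 * n + 2) * (ε : ℂ) ^ (4 * n) *
            ∫ z : ℝ,
              Complex.exp (-(Complex.I * (m : ℂ) * (z : ℂ)) / (12 * (ε : ℂ) ^ 3)) *
                (yy z : ℂ) *
                ((yy z : ℂ) + 2 * Complex.I) ^ (-(2 * ((n : ℤ) + (m : ℤ)) + 3)) *
                ((yy z : ℂ) - 2 * Complex.I) ^ (-(2 * ((n : ℤ) - (m : ℤ)) + 3))) := by
  constructor
  · have h := integral_aa_pow_mul_bb ε (2 * n + 1) (2 * m + 1)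
    have h1 : (-1 : ℂ) ^ (2 * m + 1 + 1) = 1 := Even.neg_one_pow ⟨m + 1, by ring⟩
    rw [h1, one_mul] at h
    convert congrArg (fun x : ℂ => (ε : ℂ) ^ (4 * n + 2) * x) h using 1
    · congr 3 with τ
      congr 2
      · ring_nf
      · push_cast; ring
    · rw [← mul_assoc]
      congr 1
      · ring
      · congr 1 with z
        push_cast
        congr 2 <;> ring_nf
  · intro _
    have h := integral_aa_pow_mul_bb ε (2 * n) (2 * m)
    have h1 : (-1 : ℂ) ^ (2 * m + 1) = -1 := Odd.neg_one_pow ⟨m, rfl⟩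
    rw [h1] at h
    convert congrArg (fun x : ℂ => (ε : ℂ) ^ (4 * n) * x) h using 1
    · congr 3 with τ
      congr 2
      · ring_nf
      · push_cast; ring
    · rw [← mul_assoc]
      congr 1
      · ring
      · congr 1 with z
        push_cast
        congr 2 <;> ring_nf
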